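/- Let A be a finite type with at least 2 elements, let I = A × Bool with the involution (a, ε)⁻¹ := (a, ¬ε), and let X = {x : ℤ → I | for all n, x(n+1) ≠ (x(n))⁻¹} with shift map σ(x)(n) := x(n+1) and metric d(x, y) = 2^{−min{|n| : x(n) ≠ y(n)}} for x ≠ y, d(x, x) = 0. Let F : X → ℝ be Hölder continuous with F(x) > 0 for every x ∈ X. Define the topological entropy h(F) := limsup_{T→∞} (1/T)·log #{periodic points x of σ whose F-period over their minimal period is ≤ T} (a finite count for each T, since F is bounded below by a positive constant), and define the pressure P(G) := limsup_{n→∞} (1/n)·log ( Σ_{x : σⁿ(x) = x} exp( G(x) + G(σ(x)) + ⋯ + G(σ^{n−1}(x)) ) ) for continuous G. Then 0 < h(F) < ∞ and P(−h(F)·F) = 0. -/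

import Mathlib

/-- The two-sided subshift of finite type with alphabet `I = A × Bool` (the symbol
`(a, ε)` has inverse `(a, ¬ε)`), forbidding a symbol to be immediately followed by
its inverse. -/
def SubshiftX (A : Type*) : Type _ :=
  {x : ℤ → A × Bool // ∀ n : ℤ, x (n + 1) ≠ ((x n).1, !(x n).2)}

/-- The shift map `σ` on the subshift: `σ(x)(n) = x(n+1)`. -/
def shiftMap {A : Type*} (x : SubshiftX A) : SubshiftX A :=
  ⟨fun n => x.1 (n + 1), fun n => x.2 (n + 1)⟩

open Classical in
/-- The metric on the subshift: `d(x, y) = 2^{−min{|n| : x n ≠ y n}}` for `x ≠ y`,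
and `d(x, x) = 0`. -/
noncomputable def subshiftDist {A : Type*} (x y : SubshiftX A) : ℝ :=
  if x = y then 0
  else (2 : ℝ) ^ (-((sInf {k : ℕ | ∃ n : ℤ, x.1 n ≠ y.1 n ∧ n.natAbs = k} : ℕ) : ℤ))

/-- A function on the subshift is Hölder continuous if
`|F x − F y| ≤ C · d(x, y)^θ` for some `C ≥ 0` and `θ ∈ (0, 1]`. -/
def IsHolder {A : Type*} (F : SubshiftX A → ℝ) : Prop :=
  ∃ C : ℝ, 0 ≤ C ∧ ∃ θ : ℝ, θ ∈ Set.Ioc (0 : ℝ) 1 ∧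
    ∀ x y : SubshiftX A, |F x - F y| ≤ C * subshiftDist x y ^ θ

/-- The Birkhoff sum `F(x) + F(σ x) + ⋯ + F(σ^{p−1} x)`. -/
noncomputable def birkhoff {A : Type*} (F : SubshiftX A → ℝ) (p : ℕ) (x : SubshiftX A) : ℝ :=
  ∑ i ∈ Finset.range p, F (shiftMap^[i] x)

/-- The alphabet `A × Bool` carries the discrete topology. -/
instance (A : Type*) : TopologicalSpace (A × Bool) := ⊥

/-- The subshift carries the Tychonoff (product) topology, which is the topology of
the metric `subshiftDist`. -/
instance (A : Type*) : TopologicalSpace (SubshiftX A) :=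
  inferInstanceAs (TopologicalSpace
    {x : ℤ → A × Bool // ∀ n : ℤ, x (n + 1) ≠ ((x n).1, !(x n).2)})

/-- The partition function `Z_n(G) = Σ_{σⁿ x = x} exp(G(x) + G(σx) + ⋯ + G(σ^{n−1}x))`
(the set of fixed points of `σⁿ` is finite, so the finite sum `∑ᶠ` is the honest sum). -/
noncomputable def partitionSum {A : Type*} (G : SubshiftX A → ℝ) (n : ℕ) : ℝ :=
  ∑ᶠ x : {x : SubshiftX A // shiftMap^[n] x = x}, Real.exp (birkhoff G n x.1)

/-- The pressure `P(G) := limsup_{n→∞} (1/n) · log Z_n(G)`. -/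
noncomputable def pressure {A : Type*} (G : SubshiftX A → ℝ) : ℝ :=
  Filter.limsup (fun n : ℕ => Real.log (partitionSum G n) / (n : ℝ)) Filter.atTop

/-- The number of periodic points of `σ` whose `F`-period over their minimal period
is at most `T`. -/
noncomputable def periodicCount {A : Type*} (F : SubshiftX A → ℝ) (T : ℝ) : ℕ :=
  Nat.card {x : SubshiftX A // ∃ p : ℕ, 1 ≤ p ∧ shiftMap^[p] x = x ∧
    (∀ q : ℕ, 1 ≤ q → shiftMap^[q] x = x → p ≤ q) ∧ birkhoff F p x ≤ T}

/-- The topological entropy of a positive function `F` on the subshift: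
`h(F) := limsup_{T→∞} (1/T) · log #{periodic points with F-period ≤ T}`. -/
noncomputable def topEntropy {A : Type*} (F : SubshiftX A → ℝ) : ENNReal :=
  Filter.limsup (fun T : ℝ => ENNReal.ofReal (Real.log (periodicCount F T : ℝ) / T))
    Filter.atTop

namespace PPaux

open Filter Topology

variable {A : Type*}

lemma iter_val (n : ℕ) (x : SubshiftX A) (m : ℤ) : (shiftMap^[n] x).1 m = x.1 (m + n) := by
  induction n generalizing x m with
  | zero => simp
  | succ k ih =>
    rw [Function.iterate_succ_apply, ih]
    show x.1 (m + k + 1) = _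
    exact congrArg x.1 (by push_cast; ring)

lemma fix_add_mul {n : ℕ} {x : SubshiftX A} (hx : shiftMap^[n] x = x) (m k : ℤ) :
    x.1 (m + n * k) = x.1 m := by
  have h1 : ∀ m : ℤ, x.1 (m + n) = x.1 m := fun m => by rw [← iter_val, hx]
  have h2 : ∀ (k : ℕ) (m : ℤ), x.1 (m + n * k) = x.1 m := by
    intro k
    induction k with
    | zero => simp
    | succ k ih =>
      intro m
      rw [← ih m, ← h1 (m + n * k)]
      exact congrArg x.1 (by push_cast; ring)
  obtain ⟨j, rfl | rfl⟩ := k.eq_nat_or_neg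
  · exact h2 j m
  · rw [← h2 j (m + n * (-j))]
    exact congrArg x.1 (by ring)

lemma fix_mod {n : ℕ} {x : SubshiftX A} (hx : shiftMap^[n] x = x) (m : ℤ) :
    x.1 m = x.1 (m % n) := by
  conv_lhs => rw [← Int.emod_add_mul_ediv m n]
  exact fix_add_mul hx _ _

/-- The fixed points of the `n`-th iterate. -/
def fixSet (A : Type*) (n : ℕ) : Set (SubshiftX A) := {x | shiftMap^[n] x = x}

/-- Restriction to the first `n` symbols. -/
def toWord (n : ℕ) (x : fixSet A n) : Fin n → A × Bool := fun i => x.1.1 (i.1 : ℤ)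

lemma toWord_inj {n : ℕ} (hn : 1 ≤ n) : Function.Injective (toWord (A := A) n) := by
  intro x y h
  apply Subtype.ext
  apply Subtype.ext
  funext m
  rw [fix_mod x.2 m, fix_mod y.2 m]
  have h0 : 0 ≤ m % (n : ℤ) := Int.emod_nonneg _ (by omega)
  have h1 : m % (n : ℤ) < n := Int.emod_lt_of_pos _ (by omega)
  have := congrFun h ⟨(m % (n : ℤ)).toNat, by omega⟩
  simpa [toWord, h0] using this

/-- Periodic word with positive letters. -/
def wordPt (n : ℕ) (hn : 1 ≤ n) (f : Fin n → A) : SubshiftX A :=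
  ⟨fun m => (f ⟨(m % (n : ℤ)).toNat, by
      have h0 : 0 ≤ m % (n : ℤ) := Int.emod_nonneg _ (by omega)
      have h1 : m % (n : ℤ) < n := Int.emod_lt_of_pos _ (by omega)
      omega⟩, true), fun m => by simp⟩

/-- Periodic word with positive letters, as a fixed point. -/
def ofWord (n : ℕ) (hn : 1 ≤ n) (f : Fin n → A) : fixSet A n :=
  ⟨wordPt n hn f, by
    apply Subtype.ext
    funext m
    refine (iter_val n _ m).trans ?_
    simp [wordPt]⟩

lemma ofWord_inj (n : ℕ) (hn : 1 ≤ n) : Function.Injective (ofWord (A := A) n hn) := by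
  intro f g h
  funext i
  have h2 := congrFun (congrArg (fun z : fixSet A n => z.1.1) h) (i.1 : ℤ)
  have h3 : (i.1 : ℤ) % (n : ℤ) = i.1 := Int.emod_eq_of_lt (by omega) (by have := i.2; omega)
  simpa [ofWord, wordPt, h3] using h2

lemma fix_finite [Fintype A] {n : ℕ} (hn : 1 ≤ n) : (fixSet A n).Finite :=
  Set.finite_coe_iff.mp (Finite.of_injective _ (toWord_inj (A := A) hn))


lemma card_fix_le [Fintype A] {n : ℕ} (hn : 1 ≤ n) :
    (fix_finite (A := A) hn).toFinset.card ≤ (2 * Fintype.card A) ^ n := by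
  have := Nat.card_le_card_of_injective _ (toWord_inj (A := A) hn)
  rw [Nat.card_coe_set_eq, Set.ncard_eq_toFinset_card _ (fix_finite hn)] at this
  simpa [mul_comm] using this

lemma le_card_fix [Fintype A] (hA : 2 ≤ Fintype.card A) {n : ℕ} (hn : 1 ≤ n) :
    2 ^ n ≤ (fix_finite (A := A) hn).toFinset.card := by
  have : Finite (fixSet A n) := fix_finite hn
  have := Nat.card_le_card_of_injective _ (ofWord_inj (A := A) n hn)
  rw [Nat.card_coe_set_eq (fixSet A n), Set.ncard_eq_toFinset_card _ (fix_finite hn)] at this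
  refine le_trans ?_ this
  simpa using Nat.pow_le_pow_left hA n

lemma dist_le {x y : SubshiftX A} {N : ℕ}
    (h : ∀ n ∈ Finset.Icc (-(N : ℤ)) N, y.1 n = x.1 n) :
    subshiftDist y x ≤ (2 : ℝ)⁻¹ ^ N := by
  unfold subshiftDist
  split_ifs with hxy
  · positivity
  · have hne : {k : ℕ | ∃ n : ℤ, y.1 n ≠ x.1 n ∧ n.natAbs = k}.Nonempty := by
      by_contra hcon
      apply hxy
      apply Subtype.ext
      funext n
      by_contra hn
      exact hcon ⟨_, n, hn, rfl⟩
    obtain ⟨n, hn, hk⟩ := Nat.sInf_mem hne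
    have hN : N ≤ n.natAbs := by
      by_contra hlt
      exact hn (h n (by rw [Finset.mem_Icc]; omega))
    rw [← hk, zpow_neg, zpow_natCast, ← inv_pow]
    exact pow_le_pow_of_le_one (by norm_num) (by norm_num) hN

lemma dist_nonneg (x y : SubshiftX A) : 0 ≤ subshiftDist x y := by
  unfold subshiftDist
  split_ifs <;> positivity

lemma holder_cont {F : SubshiftX A → ℝ} (hF : IsHolder F) : Continuous F := by
  obtain ⟨C, hC, θ, ⟨hθ, -⟩, h⟩ := hF
  rw [continuous_iff_continuousAt]
  intro x
  rw [ContinuousAt, Metric.tendsto_nhds]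
  intro ε hε
  have hlim : Tendsto (fun N : ℕ => C * ((2 : ℝ)⁻¹ ^ N) ^ θ) atTop (𝓝 0) := by
    have h1 : Tendsto (fun N : ℕ => (2 : ℝ)⁻¹ ^ N) atTop (𝓝 0) :=
      tendsto_pow_atTop_nhds_zero_of_lt_one (by norm_num) (by norm_num)
    have h2 := (h1.rpow_const (p := θ) (Or.inr hθ.le)).const_mul C
    simpa [Real.zero_rpow hθ.ne'] using h2
  obtain ⟨N, hN⟩ := (hlim.eventually (gt_mem_nhds hε)).exists
  have hev : ∀ᶠ y : SubshiftX A in 𝓝 x, ∀ n ∈ Finset.Icc (-(N : ℤ)) N, y.1 n = x.1 n := by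
    rw [Filter.eventually_all_finset]
    intro n _
    have hc : Continuous (fun y : SubshiftX A => y.1 n) :=
      (continuous_apply n).comp continuous_subtype_val
    have : DiscreteTopology (A × Bool) := ⟨rfl⟩
    exact hc.continuousAt.eventually (p := fun z => z = x.1 n)
      ((isOpen_discrete {x.1 n}).mem_nhds rfl)
  filter_upwards [hev] with y hy
  rw [Real.dist_eq]
  refine lt_of_le_of_lt (h y x) (lt_of_le_of_lt ?_ hN)
  exact mul_le_mul_of_nonneg_left (Real.rpow_le_rpow (dist_nonneg _ _) (dist_le hy) hθ.le) hC

lemma compactX [Fintype A] : CompactSpace (SubshiftX A) := by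
  have : DiscreteTopology (A × Bool) := ⟨rfl⟩
  have : CompactSpace (A × Bool) := Finite.compactSpace
  have hcl : IsClosed {x : ℤ → A × Bool | ∀ n : ℤ, x (n + 1) ≠ ((x n).1, !(x n).2)} := by
    rw [Set.ofPred_forall]
    refine isClosed_iInter fun n => ?_
    have hc : Continuous (fun x : ℤ → A × Bool => ((x (n+1), x n))) :=
      (continuous_apply _).prodMk (continuous_apply _)
    exact (isClosed_discrete
      {z : (A × Bool) × (A × Bool) | z.1 ≠ (z.2.1, !z.2.2)}).preimage hc
  exact isCompact_iff_compactSpace.mp hcl.isCompact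

lemma bounds [Fintype A] (hA : 2 ≤ Fintype.card A) {F : SubshiftX A → ℝ} (hF : IsHolder F)
    (hFpos : ∀ x : SubshiftX A, 0 < F x) :
    ∃ a b : ℝ, 0 < a ∧ 0 < b ∧ (∀ x, a ≤ F x) ∧ ∀ x, F x ≤ b := by
  have := compactX (A := A)
  have : Nonempty A := Fintype.card_pos_iff.mp (by omega)
  have : Nonempty (SubshiftX A) := ⟨wordPt 1 le_rfl (fun _ => Classical.arbitrary A)⟩
  have hc := holder_cont hF
  obtain ⟨x, -, hx⟩ := isCompact_univ.exists_isMinOn Set.univ_nonempty hc.continuousOn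
  obtain ⟨y, -, hy⟩ := isCompact_univ.exists_isMaxOn Set.univ_nonempty hc.continuousOn
  exact ⟨F x, F y, hFpos x, hFpos y, fun z => hx (Set.mem_univ z), fun z => hy (Set.mem_univ z)⟩

/-- The partition function with parameter `s`. -/
noncomputable def Z (F : SubshiftX A → ℝ) (s : ℝ) (n : ℕ) : ℝ :=
  partitionSum (fun x => -s * F x) n

lemma birkhoff_mul (F : SubshiftX A → ℝ) (s : ℝ) (n : ℕ) (x : SubshiftX A) :
    birkhoff (fun x => -s * F x) n x = -s * birkhoff F n x := by
  simp [birkhoff, Finset.mul_sum]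

lemma Z_eq [Fintype A] (F : SubshiftX A → ℝ) (s : ℝ) {n : ℕ} (hn : 1 ≤ n) :
    Z F s n = ∑ x ∈ (fix_finite (A := A) hn).toFinset, Real.exp (-s * birkhoff F n x) := by
  unfold Z partitionSum
  simp only [birkhoff_mul]
  have h1 := finsum_set_coe_eq_finsum_mem (f := fun x => Real.exp (-s * birkhoff F n x))
    (fixSet A n)
  have h2 := finsum_mem_eq_finite_toFinset_sum (fun x => Real.exp (-s * birkhoff F n x))
    (fix_finite (A := A) hn)
  exact h1.trans h2

lemma Z_nonneg (F : SubshiftX A → ℝ) (s : ℝ) (n : ℕ) : 0 ≤ Z F s n :=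
  finsum_nonneg fun _ => (Real.exp_pos _).le

lemma birk_ge {F : SubshiftX A → ℝ} {a : ℝ} (ha : ∀ x, a ≤ F x) (n : ℕ) (x : SubshiftX A) :
    n * a ≤ birkhoff F n x := by
  simpa [birkhoff] using Finset.card_nsmul_le_sum (Finset.range n) (fun i => F (shiftMap^[i] x)) a
    (fun i _ => ha _)

lemma birk_le {F : SubshiftX A → ℝ} {b : ℝ} (hb : ∀ x, F x ≤ b) (n : ℕ) (x : SubshiftX A) :
    birkhoff F n x ≤ n * b := by
  simpa [birkhoff] using Finset.sum_le_card_nsmul (Finset.range n) (fun i => F (shiftMap^[i] x)) b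
    (fun i _ => hb _)

lemma Z_upper [Fintype A] {F : SubshiftX A → ℝ} {a s : ℝ} (ha : ∀ x, a ≤ F x) (hs : 0 ≤ s)
    {n : ℕ} (hn : 1 ≤ n) :
    Z F s n ≤ ((2 * Fintype.card A : ℕ) * Real.exp (-(s * a))) ^ n := by
  rw [Z_eq F s hn, mul_pow, ← Real.exp_nat_mul]
  calc _ ≤ (fix_finite (A := A) hn).toFinset.card • Real.exp (n * -(s * a)) := by
        apply Finset.sum_le_card_nsmul
        intro x _
        apply Real.exp_le_exp.mpr
        nlinarith [mul_le_mul_of_nonneg_left (birk_ge ha n x) hs]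
    _ ≤ _ := by
        rw [nsmul_eq_mul]
        gcongr
        exact_mod_cast card_fix_le hn

lemma Z_lower [Fintype A] (hA : 2 ≤ Fintype.card A) {F : SubshiftX A → ℝ} {b s : ℝ}
    (hb : ∀ x, F x ≤ b) (hs : 0 ≤ s) {n : ℕ} (hn : 1 ≤ n) :
    (2 * Real.exp (-(s * b))) ^ n ≤ Z F s n := by
  rw [Z_eq F s hn, mul_pow, ← Real.exp_nat_mul]
  calc _ ≤ (fix_finite (A := A) hn).toFinset.card • Real.exp (n * -(s * b)) := by
        rw [nsmul_eq_mul]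
        gcongr
        exact_mod_cast le_card_fix hA hn
    _ ≤ _ := by
        apply Finset.card_nsmul_le_sum
        intro x _
        apply Real.exp_le_exp.mpr
        nlinarith [mul_le_mul_of_nonneg_left (birk_le hb n x) hs]

lemma Z_shift [Fintype A] {F : SubshiftX A → ℝ} {b s t : ℝ}
    (hb : ∀ x, F x ≤ b) (ht : 0 ≤ t) {n : ℕ} (hn : 1 ≤ n) :
    Z F s n ≤ Real.exp (t * b) ^ n * Z F (s + t) n := by
  rw [Z_eq F s hn, Z_eq F (s + t) hn, ← Real.exp_nat_mul, Finset.mul_sum]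
  apply Finset.sum_le_sum
  intro x _
  rw [← Real.exp_add]
  apply Real.exp_le_exp.mpr
  nlinarith [mul_le_mul_of_nonneg_left (birk_le hb n x) ht]

/-- The points counted by `periodicCount`. -/
def perSet (F : SubshiftX A → ℝ) (T : ℝ) : Set (SubshiftX A) :=
  {x | ∃ p : ℕ, 1 ≤ p ∧ shiftMap^[p] x = x ∧
    (∀ q : ℕ, 1 ≤ q → shiftMap^[q] x = x → p ≤ q) ∧ birkhoff F p x ≤ T}

lemma count_eq (F : SubshiftX A → ℝ) (T : ℝ) : periodicCount F T = (perSet F T).ncard := by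
  rw [← Nat.card_coe_set_eq]
  rfl

lemma perSet_finite [Fintype A] {F : SubshiftX A → ℝ} {a : ℝ} (ha0 : 0 < a)
    (ha : ∀ x, a ≤ F x) (T : ℝ) : (perSet F T).Finite := by
  obtain ⟨N, hN⟩ := exists_nat_gt (T / a)
  have hfin : (⋃ p ∈ Set.Icc 1 N, fixSet A p).Finite :=
    (Set.finite_Icc 1 N).biUnion fun p hp => fix_finite hp.1
  refine hfin.subset ?_
  rintro x ⟨p, hp, hx, -, hT⟩
  have h1 := (birk_ge ha p x).trans hT
  have h2 : (p : ℝ) ≤ N := ((le_div_iff₀ ha0).mpr h1).trans hN.le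
  exact Set.mem_biUnion (show p ∈ Set.Icc 1 N from ⟨hp, by exact_mod_cast h2⟩) hx

lemma mem_per {F : SubshiftX A → ℝ} {T : ℝ} {x : SubshiftX A} (hx : x ∈ perSet F T) :
    1 ≤ Function.minimalPeriod shiftMap x ∧ birkhoff F (Function.minimalPeriod shiftMap x) x ≤ T := by
  obtain ⟨p, hp, hx, hm, hT⟩ := hx
  have hP : Function.IsPeriodicPt shiftMap p x := hx
  have h1 : 0 < Function.minimalPeriod shiftMap x := hP.minimalPeriod_pos hp
  have h2 : p = Function.minimalPeriod shiftMap x :=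
    le_antisymm (hm _ h1 (Function.isPeriodicPt_minimalPeriod _ _)) (hP.minimalPeriod_le hp)
  exact ⟨h1, h2 ▸ hT⟩

lemma per_mem {F : SubshiftX A → ℝ} {T : ℝ} {x : SubshiftX A}
    (h1 : 1 ≤ Function.minimalPeriod shiftMap x)
    (hT : birkhoff F (Function.minimalPeriod shiftMap x) x ≤ T) : x ∈ perSet F T :=
  ⟨_, h1, Function.isPeriodicPt_minimalPeriod _ _,
    fun _ hq hx => Function.IsPeriodicPt.minimalPeriod_le hq hx, hT⟩

lemma count_le [Fintype A] {F : SubshiftX A → ℝ} {a s : ℝ} (ha0 : 0 < a)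
    (ha : ∀ x, a ≤ F x) (hs : 0 ≤ s) (hsum : Summable (Z F s)) (T : ℝ) :
    (periodicCount F T : ℝ) ≤ Real.exp (s * T) * ∑' n, Z F s n := by
  classical
  rw [count_eq, Set.ncard_eq_toFinset_card _ (perSet_finite ha0 ha T)]
  set t := (perSet_finite ha0 ha T).toFinset with ht
  have htm : ∀ x ∈ t, x ∈ perSet F T := fun x hx => by simpa [ht] using hx
  have key : ∑ x ∈ t, Real.exp (-s * birkhoff F (Function.minimalPeriod shiftMap x) x)
      ≤ ∑' n, Z F s n := by
    rw [← Finset.sum_fiberwise_of_maps_to (t := t.image (Function.minimalPeriod shiftMap))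
      (g := Function.minimalPeriod shiftMap) (fun x hx => Finset.mem_image_of_mem _ hx)]
    refine le_trans (Finset.sum_le_sum ?_)
      (hsum.sum_le_tsum (t.image (Function.minimalPeriod shiftMap)) fun n _ => Z_nonneg F s n)
    intro n hn
    obtain ⟨y, hy, rfl⟩ := Finset.mem_image.mp hn
    have hn1 := (mem_per (htm y hy)).1
    rw [Z_eq F s hn1]
    set n := Function.minimalPeriod shiftMap y
    calc _ = ∑ x ∈ t with Function.minimalPeriod shiftMap x = n,
          Real.exp (-s * birkhoff F n x) := by
          apply Finset.sum_congr rfl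
          intro x hx
          rw [(Finset.mem_filter.mp hx).2]
      _ ≤ _ := by
          apply Finset.sum_le_sum_of_subset_of_nonneg
          · intro x hx
            have h2 := (Finset.mem_filter.mp hx).2
            rw [Set.Finite.mem_toFinset]
            show shiftMap^[n] x = x
            rw [← h2]
            exact Function.isPeriodicPt_minimalPeriod _ _
          · intro x _ _
            positivity
  have h2 : (t.card : ℝ) * Real.exp (-s * T) ≤ ∑' n, Z F s n := by
    refine le_trans ?_ key
    rw [← nsmul_eq_mul]
    apply Finset.card_nsmul_le_sum
    intro x hx
    apply Real.exp_le_exp.mpr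
    nlinarith [mul_le_mul_of_nonneg_left (mem_per (htm x hx)).2 hs]
  calc (t.card : ℝ) = Real.exp (s * T) * (t.card * Real.exp (-s * T)) := by
        rw [mul_left_comm, ← Real.exp_add]
        simp
    _ ≤ _ := by gcongr

lemma entropy_le [Fintype A] {F : SubshiftX A → ℝ} {a s : ℝ} (ha0 : 0 < a)
    (ha : ∀ x, a ≤ F x) (hs : 0 ≤ s) (hsum : Summable (Z F s)) :
    topEntropy F ≤ ENNReal.ofReal s := by
  set K := max 1 (∑' n, Z F s n) with hK
  have hK1 : 1 ≤ K := le_max_left _ _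
  have hlim : Tendsto (fun T : ℝ => ENNReal.ofReal (s + Real.log K / T)) atTop
      (𝓝 (ENNReal.ofReal s)) := by
    apply ENNReal.tendsto_ofReal
    simpa using (tendsto_const_nhds (x := s)).add
      ((tendsto_const_nhds (x := Real.log K)).div_atTop tendsto_id)
  unfold topEntropy
  rw [← hlim.limsup_eq]
  refine limsup_le_limsup ?_
  · filter_upwards [eventually_gt_atTop 0] with T hT
    apply ENNReal.ofReal_le_ofReal
    have h1 : Real.log (periodicCount F T) ≤ s * T + Real.log K := by
      rcases Nat.eq_zero_or_pos (periodicCount F T) with h0 | h0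
      · rw [h0]
        have := Real.log_nonneg hK1
        simp
        positivity
      · calc _ ≤ Real.log (Real.exp (s * T) * K) := by
              apply Real.log_le_log (by exact_mod_cast h0)
              refine (count_le ha0 ha hs hsum T).trans ?_
              gcongr
              exact le_max_right _ _
          _ = _ := by rw [Real.log_mul (by positivity) (by positivity), Real.log_exp]
    calc _ ≤ (s * T + Real.log K) / T := by gcongr
      _ = _ := by field_simp

lemma Z_bounded [Fintype A] {F : SubshiftX A → ℝ} {a s : ℝ} (ha0 : 0 < a)
    (ha : ∀ x, a ≤ F x) (hs : 0 < s) (hlt : topEntropy F < ENNReal.ofReal s) :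
    ∃ K : ℝ, 1 ≤ K ∧ ∀ n, 1 ≤ n → Z F s n ≤ K := by
  classical
  obtain ⟨c, hc1, hc2⟩ := exists_between hlt
  have hctop : c ≠ ⊤ := hc2.ne_top
  set r := c.toReal with hr
  have hr0 : 0 ≤ r := ENNReal.toReal_nonneg
  have hcr : c = ENNReal.ofReal r := (ENNReal.ofReal_toReal hctop).symm
  have hrs : r < s := by
    rw [hcr] at hc2
    exact (ENNReal.ofReal_lt_ofReal_iff hs).mp hc2
  have hev : ∀ᶠ T : ℝ in atTop, (periodicCount F T : ℝ) ≤ Real.exp (r * T) := by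
    have := eventually_lt_of_limsup_lt hc1
    filter_upwards [this, eventually_gt_atTop 0] with T hT hT0
    rw [hcr] at hT
    have h1 := (ENNReal.ofReal_le_ofReal_iff hr0).mp hT.le
    rw [div_le_iff₀ hT0] at h1
    rcases Nat.eq_zero_or_pos (periodicCount F T) with h0 | h0
    · rw [h0]
      simp
      positivity
    · exact (Real.log_le_iff_le_exp (by exact_mod_cast h0)).mp h1
  have hev2 : ∀ᶠ k : ℕ in atTop, (periodicCount F (k + 1 : ℝ) : ℝ) ≤ Real.exp (r * (k + 1)) :=
    (tendsto_atTop_add_const_right atTop (1 : ℝ) tendsto_natCast_atTop_atTop).eventually hev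
  have hgeo : Summable (fun k : ℕ => Real.exp r * Real.exp (r - s) ^ k) :=
    (summable_geometric_of_lt_one (Real.exp_pos _).le
      (Real.exp_lt_one_iff.mpr (by linarith))).mul_left _
  have hsum : Summable (fun k : ℕ => (periodicCount F (k + 1 : ℝ) : ℝ) * Real.exp (-s * k)) := by
    refine Summable.of_norm_bounded_eventually_nat hgeo ?_
    filter_upwards [hev2] with k hk
    rw [Real.norm_of_nonneg (by positivity)]
    calc _ ≤ Real.exp (r * (k + 1)) * Real.exp (-s * k) := by gcongr
      _ = _ := by
        rw [← Real.exp_nat_mul, ← Real.exp_add, ← Real.exp_add]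
        ring_nf
  refine ⟨max 1 (∑' k : ℕ, (periodicCount F (k + 1 : ℝ) : ℝ) * Real.exp (-s * k)),
    le_max_left _ _, fun n hn => le_trans ?_ (le_max_right _ _)⟩
  rw [Z_eq F s hn]
  set t := (fix_finite (A := A) hn).toFinset with ht
  set ℓ : SubshiftX A → ℝ := fun x => birkhoff F (Function.minimalPeriod shiftMap x) x with hℓ
  have hℓ0 : ∀ x, 0 ≤ ℓ x := fun x =>
    le_trans (by positivity) (birk_ge ha (Function.minimalPeriod shiftMap x) x)
  have htm : ∀ x ∈ t, Function.IsPeriodicPt shiftMap n x := fun x hx => by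
    rw [ht, Set.Finite.mem_toFinset] at hx
    exact hx
  have h1 : ∑ x ∈ t, Real.exp (-s * birkhoff F n x) ≤ ∑ x ∈ t, Real.exp (-s * ⌊ℓ x⌋₊) := by
    apply Finset.sum_le_sum
    intro x hx
    apply Real.exp_le_exp.mpr
    have h2 : ℓ x ≤ birkhoff F n x := by
      apply Finset.sum_le_sum_of_subset_of_nonneg
      · intro i hi
        have := (htm x hx).minimalPeriod_le hn
        rw [Finset.mem_range] at *
        omega
      · intro i _ _
        exact ha0.le.trans (ha _)
    have h3 := Nat.floor_le (hℓ0 x)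
    nlinarith
  refine h1.trans ?_
  rw [← Finset.sum_fiberwise_of_maps_to (t := t.image (fun x => ⌊ℓ x⌋₊))
      (g := fun x => ⌊ℓ x⌋₊) (fun x hx => Finset.mem_image_of_mem _ hx)]
  refine le_trans (Finset.sum_le_sum ?_)
      (hsum.sum_le_tsum (t.image (fun x => ⌊ℓ x⌋₊)) fun n _ => by positivity)
  intro k _
  calc _ = ∑ x ∈ t with ⌊ℓ x⌋₊ = k, Real.exp (-s * k) := by
        apply Finset.sum_congr rfl
        intro x hx
        rw [(Finset.mem_filter.mp hx).2]
    _ ≤ _ := by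
        rw [Finset.sum_const, nsmul_eq_mul]
        gcongr
        rw [count_eq, Set.ncard_eq_toFinset_card _ (perSet_finite ha0 ha _)]
        apply Finset.card_le_card
        intro x hx
        obtain ⟨hx1, hx2⟩ := Finset.mem_filter.mp hx
        rw [Set.Finite.mem_toFinset]
        refine per_mem ((htm x hx1).minimalPeriod_pos hn) ?_
        have := Nat.lt_floor_add_one (ℓ x)
        rw [hx2] at this
        exact this.le

/-- Eventual exponential decay of the partition function gives summability. -/
lemma summable_of_decay {F : SubshiftX A → ℝ} {s c : ℝ} (hc : 0 < c)
    (h : ∀ᶠ n : ℕ in atTop, Z F s n ≤ Real.exp (-c) ^ n) : Summable (Z F s) := by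
  refine Summable.of_norm_bounded_eventually_nat
    (summable_geometric_of_lt_one (Real.exp_pos (-c)).le (Real.exp_lt_one_iff.mpr (by linarith))) ?_
  filter_upwards [h] with n hn
  rwa [Real.norm_of_nonneg (Z_nonneg F s n)]

theorem main [Fintype A] (hA : 2 ≤ Fintype.card A)
    (F : SubshiftX A → ℝ) (hF : IsHolder F) (hFpos : ∀ x : SubshiftX A, 0 < F x) :
    0 < topEntropy F ∧ topEntropy F < ⊤ ∧
      pressure (fun x => -(topEntropy F).toReal * F x) = 0 := by
  obtain ⟨a, b, ha0, hb0, ha, hb⟩ := bounds hA hF hFpos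
  have hM : (0 : ℝ) < (2 * Fintype.card A : ℕ) := by
    have : 0 < 2 * Fintype.card A := by omega
    exact_mod_cast this
  have hZpos : ∀ s, 0 ≤ s → ∀ n, 1 ≤ n → 0 < Z F s n := fun s hs n hn =>
    lt_of_lt_of_le (by positivity) (Z_lower hA hb hs hn)
  have hfin : topEntropy F < ⊤ := by
    set s := (|Real.log (2 * Fintype.card A : ℕ)| + 1) / a with hs
    have hs0 : 0 ≤ s := by positivity
    have hsa : s * a = |Real.log (2 * Fintype.card A : ℕ)| + 1 := by
      rw [hs]
      field_simp
    refine lt_of_le_of_lt (entropy_le ha0 ha hs0 (summable_of_decay one_pos ?_))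
      ENNReal.ofReal_lt_top
    filter_upwards [eventually_ge_atTop 1] with n hn
    refine (Z_upper ha hs0 hn).trans ?_
    apply pow_le_pow_left₀ (by positivity)
    conv_lhs => rw [← Real.exp_log hM, ← Real.exp_add]
    apply Real.exp_le_exp.mpr
    rw [hsa]
    linarith [le_abs_self (Real.log (2 * Fintype.card A : ℕ))]
  have hpos : 0 < topEntropy F := by
    set s := Real.log 2 / (2 * b) with hs
    have hl2 : 0 < Real.log 2 := Real.log_pos (by norm_num)
    have hs0 : 0 < s := by positivity
    have hsb : s * b = Real.log 2 / 2 := by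
      rw [hs]
      field_simp
    by_contra hcon
    have h0 : topEntropy F < ENNReal.ofReal s :=
      lt_of_le_of_lt (not_lt.mp hcon) (ENNReal.ofReal_pos.mpr hs0)
    obtain ⟨K, hK, hZ⟩ := Z_bounded ha0 ha hs0 h0
    have h1 : 1 < 2 * Real.exp (-(s * b)) := by
      conv_rhs => rw [← Real.exp_log (show (0 : ℝ) < 2 by norm_num), ← Real.exp_add]
      rw [Real.one_lt_exp_iff, hsb]
      linarith
    obtain ⟨n, hn1, hn2⟩ := ((eventually_ge_atTop 1).and
      ((tendsto_pow_atTop_atTop_of_one_lt h1).eventually_gt_atTop K)).exists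
    exact absurd ((Z_lower hA hb hs0.le hn1).trans (hZ n hn1)) (not_le.mpr hn2)
  refine ⟨hpos, hfin, ?_⟩
  set h := (topEntropy F).toReal with hh
  have hh0 : 0 < h := ENNReal.toReal_pos hpos.ne' hfin.ne
  have hhe : topEntropy F = ENNReal.ofReal h := (ENNReal.ofReal_toReal hfin.ne).symm
  set u : ℕ → ℝ := fun n => Real.log (Z F h n) / n with hu
  show limsup u atTop = 0
  have hlow : ∀ᶠ n in atTop, Real.log (2 * Real.exp (-(h * b))) ≤ u n := by
    filter_upwards [eventually_ge_atTop 1] with n hn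
    have hn0 : (0 : ℝ) < n := by exact_mod_cast hn
    rw [hu]
    dsimp only
    rw [le_div_iff₀ hn0, mul_comm, ← Real.log_pow]
    exact Real.log_le_log (by positivity) (Z_lower hA hb hh0.le hn)
  have hup : ∀ᶠ n in atTop, u n ≤ Real.log ((2 * Fintype.card A : ℕ) * Real.exp (-(h * a))) := by
    filter_upwards [eventually_ge_atTop 1] with n hn
    have hn0 : (0 : ℝ) < n := by exact_mod_cast hn
    rw [hu]
    dsimp only
    rw [div_le_iff₀ hn0, mul_comm, ← Real.log_pow]
    exact Real.log_le_log (hZpos h hh0.le n hn) (Z_upper ha hh0.le hn)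
  have hbdd : IsBoundedUnder (· ≤ ·) atTop u := ⟨_, hup⟩
  have hcob : IsCoboundedUnder (· ≤ ·) atTop u :=
    IsBoundedUnder.isCoboundedUnder_le ⟨_, hlow⟩
  apply le_antisymm
  · apply le_of_forall_pos_le_add
    intro ε hε
    rw [zero_add]
    set δ := ε / (2 * b) with hδ
    have hδ0 : 0 < δ := by positivity
    have hδb : δ * b = ε / 2 := by
      rw [hδ]
      field_simp
    obtain ⟨K, hK, hZ⟩ := Z_bounded (s := h + δ) ha0 ha (by positivity) (by
      rw [hhe]
      exact (ENNReal.ofReal_lt_ofReal_iff (by positivity)).mpr (by linarith))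
    have hlim : Tendsto (fun n : ℕ => Real.log K / (n : ℝ)) atTop (𝓝 0) :=
      tendsto_const_nhds.div_atTop tendsto_natCast_atTop_atTop
    apply limsup_le_of_le hcob
    filter_upwards [eventually_ge_atTop 1, hlim.eventually (gt_mem_nhds (half_pos hε))]
      with n hn hKn
    have hn0 : (0 : ℝ) < n := by exact_mod_cast hn
    have h1 : Z F h n ≤ Real.exp (δ * b) ^ n * K := by
      refine (Z_shift (s := h) hb hδ0.le hn).trans ?_
      gcongr
      exact hZ n hn
    have h2 : Real.log (Z F h n) ≤ n * (ε / 2) + Real.log K := by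
      refine (Real.log_le_log (hZpos h hh0.le n hn) h1).trans (le_of_eq ?_)
      rw [Real.log_mul (by positivity) (by positivity), Real.log_pow, Real.log_exp, hδb]
    calc u n ≤ (n * (ε / 2) + Real.log K) / n := by
          rw [hu]
          dsimp only
          gcongr
      _ = ε / 2 + Real.log K / n := by field_simp
      _ ≤ ε := by linarith
  · by_contra hcon
    push Not at hcon
    obtain ⟨c, hc1, hc2⟩ := exists_between hcon
    have hev := eventually_lt_of_limsup_lt hc1 hbdd
    set δ := min (h / 2) (-c / (2 * b)) with hδ
    have hδ0 : 0 < δ := lt_min (by positivity) (div_pos (by linarith) (by positivity))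
    have hδh : δ < h := lt_of_le_of_lt (min_le_left _ _) (by linarith)
    have hδb : δ * b ≤ -c / 2 := by
      calc δ * b ≤ (-c / (2 * b)) * b := by
            gcongr
            exact min_le_right _ _
        _ = _ := by field_simp
    have hsum : Summable (Z F (h - δ)) := by
      refine summable_of_decay (c := -c / 2) (by linarith) ?_
      filter_upwards [eventually_ge_atTop 1, hev] with n hn hcn
      have hn0 : (0 : ℝ) < n := by exact_mod_cast hn
      have h1 : Z F h n ≤ Real.exp c ^ n := by
        rw [← Real.exp_nat_mul, ← Real.log_le_iff_le_exp (hZpos h hh0.le n hn)]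
        have h2 : Real.log (Z F h n) / n < c := hcn
        rw [div_lt_iff₀ hn0] at h2
        linarith
      have h3 := Z_shift (s := h - δ) (F := F) hb hδ0.le hn
      rw [sub_add_cancel] at h3
      refine h3.trans ?_
      calc _ ≤ Real.exp (δ * b) ^ n * Real.exp c ^ n := by gcongr
        _ = Real.exp (δ * b + c) ^ n := by rw [← mul_pow, ← Real.exp_add]
        _ ≤ _ := by
          apply pow_le_pow_left₀ (Real.exp_pos _).le
          apply Real.exp_le_exp.mpr
          linarith
    have h4 := entropy_le ha0 ha (by linarith) hsum
    rw [hhe, ENNReal.ofReal_le_ofReal_iff (by linarith)] at h4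
    linarith

end PPaux

/-- Parry–Pollicott: for a positive Hölder continuous `F`, the topological entropy
`h(F)` is finite and strictly positive and satisfies `P(−h(F)·F) = 0`. -/
theorem entropy_pos_finite_and_pressure_zero {A : Type*} [Fintype A]
    (hA : 2 ≤ Fintype.card A)
    (F : SubshiftX A → ℝ) (hF : IsHolder F) (hFpos : ∀ x : SubshiftX A, 0 < F x) :
    0 < topEntropy F ∧ topEntropy F < ⊤ ∧
      pressure (fun x => -(topEntropy F).toReal * F x) = 0 := by
  exact PPaux.main hA F hF hFpos
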